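/- On the level set ⟨γ, M⟩ = 0, the map (γ, M) ↦ (γ̂, M̂) with γ̂_j = √(g(γ)(1 − d⟨γ,γ⟩a_j))·γ_j and M̂_j = (Π_{i≠j}(1 − d⟨γ,γ⟩a_i))^{−1/2}·(M_j/√g(γ) + d√g(γ)·⟨M,Aγ⟩·γ_j) pulls the deformed bracket {·,·}_d back to the standard Lie–Poisson bracket: {γ̂_i, γ̂_j}_d = 0, {M̂_i, γ̂_j}_d = ε_{ijk} γ̂_k, {M̂_i, M̂_j}_d = ε_{ijk} M̂_k. -/

import Mathlib

open Matrix Filter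

noncomputable section

/-- Index type for the phase space ℝ³×ℝ³: `Sum.inl` indexes γ, `Sum.inr` indexes M. -/
abbrev Idx : Type := Fin 3 ⊕ Fin 3

/-- The phase space ℝ⁶ of the variables (γ, M). -/
abbrev V : Type := Idx → ℝ

/-- The totally antisymmetric Levi-Civita symbol on `Fin 3` with ε₀₁₂ = 1. -/
def eps (i j k : Fin 3) : ℝ :=
  (((i : ℕ) : ℝ) - ((j : ℕ) : ℝ)) * (((j : ℕ) : ℝ) - ((k : ℕ) : ℝ)) *
    (((k : ℕ) : ℝ) - ((i : ℕ) : ℝ)) / 2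

def gI (i : Fin 3) : Idx := Sum.inl i
def mI (i : Fin 3) : Idx := Sum.inr i

/-- The γ-part of a phase point. -/
def gPart (x : V) : Fin 3 → ℝ := fun i => x (gI i)

/-- The M-part of a phase point. -/
def mPart (x : V) : Fin 3 → ℝ := fun i => x (mI i)

/-- Partial derivative of `f` at `x` in the coordinate direction `a`. -/
def pd (f : V → ℝ) (x : V) (a : Idx) : ℝ := fderiv ℝ f x (Pi.single a 1)

/-- Bracket with structure functions `{M_i,M_j} = Σ_k ε_{ijk}·cM x k`,
`{M_i,γ_j} = Σ_k ε_{ijk}·cG x k`, `{γ_i,γ_j} = 0`, extended to functions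
via partial derivatives. -/
def bracket (cM cG : V → Fin 3 → ℝ) (f g : V → ℝ) (x : V) : ℝ :=
  ∑ i : Fin 3, ∑ j : Fin 3, ∑ k : Fin 3, eps i j k *
    (cM x k * pd f x (mI i) * pd g x (mI j)
      + cG x k * (pd f x (mI i) * pd g x (gI j) + pd f x (gI i) * pd g x (mI j)))

/-- Structure functions of the standard Lie–Poisson bracket on e*(3). -/
def cMstd (x : V) : Fin 3 → ℝ := mPart x

def cGstd (x : V) : Fin 3 → ℝ := gPart x

/-- A = diag(a₁,a₂,a₃). -/
def Amat (a₁ a₂ a₃ : ℝ) : Matrix (Fin 3) (Fin 3) ℝ := Matrix.diagonal ![a₁, a₂, a₃]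

/-- g(γ) = (1 − d⟨γ, Aγ⟩)⁻¹. -/
def gfun (a₁ a₂ a₃ d : ℝ) (x : V) : ℝ :=
  (1 - d * (gPart x ⬝ᵥ (Amat a₁ a₂ a₃).mulVec (gPart x)))⁻¹

/-- √g(γ). -/
def sg (a₁ a₂ a₃ d : ℝ) (x : V) : ℝ := Real.sqrt (gfun a₁ a₂ a₃ d x)

/-- ⟨M, Aγ⟩. -/
def MAg (a₁ a₂ a₃ : ℝ) (x : V) : ℝ := mPart x ⬝ᵥ (Amat a₁ a₂ a₃).mulVec (gPart x)

/-- Structure functions `cM` of the deformed (Chaplygin) bracket: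
`{M_i,M_j}_d = Σ_k ε_{ijk}(M_k/√g − d√g⟨M,Aγ⟩γ_k)`. -/
def cMd (a₁ a₂ a₃ d : ℝ) (x : V) : Fin 3 → ℝ := fun k =>
  mPart x k / sg a₁ a₂ a₃ d x - d * sg a₁ a₂ a₃ d x * MAg a₁ a₂ a₃ x * gPart x k

/-- Structure functions `cG` of the deformed bracket: `{M_i,γ_j}_d = Σ_k ε_{ijk} γ_k/√g`. -/
def cGd (a₁ a₂ a₃ d : ℝ) (x : V) : Fin 3 → ℝ := fun k =>
  gPart x k / sg a₁ a₂ a₃ d x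

/-- A_d = A + d·g(γ)·(Aγ)⊗(Aγ). -/
def Adm (a₁ a₂ a₃ d : ℝ) (x : V) : Matrix (Fin 3) (Fin 3) ℝ :=
  Amat a₁ a₂ a₃ + (d * gfun a₁ a₂ a₃ d x) •
    vecMulVec ((Amat a₁ a₂ a₃).mulVec (gPart x)) ((Amat a₁ a₂ a₃).mulVec (gPart x))

/-- γ̂_j = √(g(γ)(1 − d⟨γ,γ⟩a_j))·γ_j. -/
def ghat (a₁ a₂ a₃ d : ℝ) (j : Fin 3) (x : V) : ℝ :=
  Real.sqrt (gfun a₁ a₂ a₃ d x * (1 - d * (gPart x ⬝ᵥ gPart x) * ![a₁, a₂, a₃] j))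
    * gPart x j

/-- M̂_j = (Π_{i≠j}(1 − d⟨γ,γ⟩a_i))^{-1/2}·(M_j/√g + d√g⟨M,Aγ⟩γ_j). -/
def mhat (a₁ a₂ a₃ d : ℝ) (j : Fin 3) (x : V) : ℝ :=
  (Real.sqrt (∏ i ∈ Finset.univ.erase j, (1 - d * (gPart x ⬝ᵥ gPart x) * ![a₁, a₂, a₃] i)))⁻¹
    * (mPart x j / sg a₁ a₂ a₃ d x
        + d * sg a₁ a₂ a₃ d x * MAg a₁ a₂ a₃ x * gPart x j)

/-- `f` is differentiable at `x` with partial derivatives `D`. -/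
def HasGrad (f : V → ℝ) (x : V) (D : Idx → ℝ) : Prop :=
  DifferentiableAt ℝ f x ∧ pd f x = D

namespace HasGrad

variable {f h : V → ℝ} {x : V} {D E : Idx → ℝ}

theorem add (hf : HasGrad f x D) (hh : HasGrad h x E) :
    HasGrad (fun y => f y + h y) x (D + E) := by
  obtain ⟨hf, rfl⟩ := hf
  obtain ⟨hh, rfl⟩ := hh
  refine ⟨hf.add hh, funext fun b => ?_⟩
  simp [pd, fderiv_fun_add hf hh]

theorem mul (hf : HasGrad f x D) (hh : HasGrad h x E) :
    HasGrad (fun y => f y * h y) x (f x • E + h x • D) := by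
  obtain ⟨hf, rfl⟩ := hf
  obtain ⟨hh, rfl⟩ := hh
  refine ⟨hf.mul hh, funext fun b => ?_⟩
  simp [pd, fderiv_fun_mul hf hh]

theorem comp {w : ℝ → ℝ} {w' : ℝ} (hw : HasDerivAt w w' (f x)) (hf : HasGrad f x D) :
    HasGrad (fun y => w (f y)) x (w' • D) := by
  obtain ⟨hf, rfl⟩ := hf
  have hc := hw.comp_hasFDerivAt x hf.hasFDerivAt
  refine ⟨hc.differentiableAt, funext fun b => ?_⟩
  change fderiv ℝ (w ∘ f) x _ = _
  rw [hc.fderiv]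
  rfl

theorem coord (x : V) (c : Idx) : HasGrad (fun y => y c) x (Pi.single c 1) := by
  refine ⟨by fun_prop, funext fun b => ?_⟩
  rw [pd, (hasFDerivAt_apply c x).fderiv]
  simp [Pi.single_apply, eq_comm]

theorem const_mul (c : ℝ) (hf : HasGrad f x D) : HasGrad (fun y => c * f y) x (c • D) :=
  comp (w := fun t => c * t) (by simpa using (hasDerivAt_id (f x)).const_mul c) hf

theorem congr (hf : HasGrad f x D) (hh : h =ᶠ[nhds x] f) : HasGrad h x D := by
  refine ⟨hf.1.congr_of_eventuallyEq hh, ?_⟩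
  rw [← hf.2]
  funext b
  rw [pd, pd, hh.fderiv_eq]

end HasGrad

/-- The value of the bracket on two gradients. -/
def gradBracket (m g : Fin 3 → ℝ) (D E : Idx → ℝ) : ℝ :=
  m 0 * (D (mI 1) * E (mI 2) - D (mI 2) * E (mI 1))
  + m 1 * (D (mI 2) * E (mI 0) - D (mI 0) * E (mI 2))
  + m 2 * (D (mI 0) * E (mI 1) - D (mI 1) * E (mI 0))
  + g 0 * (D (mI 1) * E (gI 2) - D (mI 2) * E (gI 1) + (D (gI 1) * E (mI 2) - D (gI 2) * E (mI 1)))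
  + g 1 * (D (mI 2) * E (gI 0) - D (mI 0) * E (gI 2) + (D (gI 2) * E (mI 0) - D (gI 0) * E (mI 2)))
  + g 2 * (D (mI 0) * E (gI 1) - D (mI 1) * E (gI 0) + (D (gI 0) * E (mI 1) - D (gI 1) * E (mI 0)))

theorem bracket_eq_gradBracket {cM cG : V → Fin 3 → ℝ} {f h : V → ℝ} {x : V} {D E : Idx → ℝ}
    (hf : HasGrad f x D) (hh : HasGrad h x E) :
    bracket cM cG f h x = gradBracket (cM x) (cG x) D E := by
  simp only [bracket, hf.2, hh.2, gradBracket, Fin.sum_univ_three, eps]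
  norm_num
  ring

/-- The gradient of half of ⟨γ, γ⟩. -/
def radial (x : V) : Idx → ℝ := Sum.elim (gPart x) 0

/-- Multiples of the gradient of ⟨γ, γ⟩ do not contribute to the bracket. -/
theorem gradBracket_casimir (m : Fin 3 → ℝ) (x : V) (r p p' t t' : ℝ) (D E : Idx → ℝ) :
    gradBracket m (fun k => r * gPart x k) (p • D + t • radial x) (p' • E + t' • radial x)
      = p * p' * gradBracket m (fun k => r * gPart x k) D E := by
  simp only [gradBracket, radial, gI, mI, Pi.add_apply, Pi.smul_apply, Sum.elim_inl,
    Sum.elim_inr, Pi.zero_apply, smul_eq_mul]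
  ring

/-- 1/√g as a square root of a polynomial. -/
def qfun (a : Fin 3 → ℝ) (d : ℝ) (x : V) : ℝ :=
  Real.sqrt (1 - d * ∑ i, a i * gPart x i * gPart x i)

/-- ⟨M, Aγ⟩ in coordinates. -/
def pairing (a : Fin 3 → ℝ) (x : V) : ℝ := ∑ i, a i * mPart x i * gPart x i

/-- The gradient of 1/√g. -/
def qgrad (a : Fin 3 → ℝ) (d : ℝ) (x : V) : Idx → ℝ :=
  Sum.elim (fun b => -(d * a b * gPart x b * (qfun a d x)⁻¹)) 0

/-- The gradient of γ_j √g. -/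
def gammaGrad (a : Fin 3 → ℝ) (d : ℝ) (j : Fin 3) (x : V) : Idx → ℝ :=
  (qfun a d x)⁻¹ • Pi.single (gI j) 1
    - (gPart x j * (qfun a d x)⁻¹ ^ 2) • qgrad a d x

/-- The unnormalised momentum M_j/√g + d√g⟨M,Aγ⟩γ_j. -/
def momentum (a : Fin 3 → ℝ) (d : ℝ) (j : Fin 3) (x : V) : ℝ :=
  qfun a d x * mPart x j + d * (pairing a x * (gPart x j * (qfun a d x)⁻¹))

/-- The gradient of ⟨M, Aγ⟩. -/
def pairingGrad (a : Fin 3 → ℝ) (x : V) : Idx → ℝ :=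
  Sum.elim (fun b => a b * mPart x b) (fun b => a b * gPart x b)

/-- The gradient of `momentum`. -/
def momentumGrad (a : Fin 3 → ℝ) (d : ℝ) (j : Fin 3) (x : V) : Idx → ℝ :=
  qfun a d x • Pi.single (mI j) 1 + mPart x j • qgrad a d x
    + d • (pairing a x • gammaGrad a d j x + (gPart x j * (qfun a d x)⁻¹) • pairingGrad a x)

section

variable {a : Fin 3 → ℝ} {d : ℝ} {x : V}

theorem hasGrad_qfun (hx : 0 < 1 - d * ∑ i, a i * gPart x i * gPart x i) :
    HasGrad (qfun a d) x (qgrad a d x) := by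
  have hc := fun i : Fin 3 => HasGrad.coord x (gI i)
  have hs : HasGrad (fun y : V => ∑ i, a i * gPart y i * gPart y i) x
      (Sum.elim (fun b => 2 * (a b * gPart x b)) 0) := by
    have := ((((hc 0).const_mul (a 0)).mul (hc 0)).add (((hc 1).const_mul (a 1)).mul (hc 1))).add
      (((hc 2).const_mul (a 2)).mul (hc 2))
    convert this using 1
    · funext y
      simp [Fin.sum_univ_three, gPart]
    · funext b
      rcases b with b | b <;> fin_cases b <;> simp [gPart, gI] <;> ring
  have hw : HasDerivAt (fun t : ℝ => Real.sqrt (1 - d * t))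
      (-d / (2 * qfun a d x)) (∑ i, a i * gPart x i * gPart x i) := by
    have h1 : HasDerivAt (fun t : ℝ => 1 - d * t) (-d) (∑ i, a i * gPart x i * gPart x i) := by
      simpa using ((hasDerivAt_id _).const_mul d).const_sub 1
    exact h1.sqrt hx.ne'
  have he : qgrad a d x =
      (-d / (2 * qfun a d x)) • Sum.elim (fun b => 2 * (a b * gPart x b)) 0 := by
    funext b
    rcases b with b | b
    · simp only [qgrad, Sum.elim_inl, Pi.smul_apply, smul_eq_mul]
      ring
    · simp [qgrad]
  rw [he]
  exact HasGrad.comp (w := fun t => Real.sqrt (1 - d * t)) hw hs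

theorem qfun_pos (hx : 0 < 1 - d * ∑ i, a i * gPart x i * gPart x i) : 0 < qfun a d x :=
  Real.sqrt_pos.2 hx

theorem hasGrad_gamma (hx : 0 < 1 - d * ∑ i, a i * gPart x i * gPart x i) (j : Fin 3) :
    HasGrad (fun y => gPart y j * (qfun a d y)⁻¹) x (gammaGrad a d j x) := by
  have he : gammaGrad a d j x =
      gPart x j • (-(qfun a d x ^ 2)⁻¹ • qgrad a d x) + (qfun a d x)⁻¹ • Pi.single (gI j) 1 := by
    rw [gammaGrad, inv_pow]
    module
  rw [he]
  exact (HasGrad.coord x (gI j)).mul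
    (HasGrad.comp (hasDerivAt_inv (qfun_pos hx).ne') (hasGrad_qfun hx))

theorem hasGrad_pairing : HasGrad (pairing a) x (pairingGrad a x) := by
  have hc := fun i : Fin 3 => HasGrad.coord x (gI i)
  have hm := fun i : Fin 3 => HasGrad.coord x (mI i)
  have := ((((hm 0).const_mul (a 0)).mul (hc 0)).add (((hm 1).const_mul (a 1)).mul (hc 1))).add
    (((hm 2).const_mul (a 2)).mul (hc 2))
  convert this using 1
  · funext y
    simp [Fin.sum_univ_three, gPart, mPart, pairing]
  · funext b
    rcases b with b | b <;> fin_cases b <;>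
      simp [gPart, mPart, gI, mI, pairingGrad] <;> ring

theorem hasGrad_momentum (hx : 0 < 1 - d * ∑ i, a i * gPart x i * gPart x i) (j : Fin 3) :
    HasGrad (momentum a d j) x (momentumGrad a d j x) :=
  ((hasGrad_qfun hx).mul (HasGrad.coord x (mI j))).add
    ((hasGrad_pairing.mul (hasGrad_gamma hx j)).const_mul d)

/-- A function of ⟨γ, γ⟩ has radial gradient. -/
theorem hasGrad_radial {w : ℝ → ℝ} (hw : DifferentiableAt ℝ w (gPart x ⬝ᵥ gPart x)) :
    ∃ t : ℝ, HasGrad (fun y => w (gPart y ⬝ᵥ gPart y)) x (t • radial x) := by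
  have hc := fun i : Fin 3 => HasGrad.coord x (gI i)
  have hs : HasGrad (fun y : V => gPart y ⬝ᵥ gPart y) x ((2 : ℝ) • radial x) := by
    have := (((hc 0).mul (hc 0)).add ((hc 1).mul (hc 1))).add ((hc 2).mul (hc 2))
    convert this using 1
    · funext y
      simp [dotProduct, Fin.sum_univ_three, gPart]
    · funext b
      rcases b with b | b <;> fin_cases b <;> simp [radial, gPart, gI] <;> ring
  refine ⟨deriv w (gPart x ⬝ᵥ gPart x) * 2, ?_⟩
  rw [mul_smul]
  exact HasGrad.comp hw.hasDerivAt hs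

/-- Factors depending only on ⟨γ, γ⟩ can be pulled out of the bracket. -/
theorem bracket_mul_radial {cM cG : V → Fin 3 → ℝ} {r : ℝ}
    (hr : cG x = fun k => r * gPart x k) {v w : ℝ → ℝ}
    (hv : DifferentiableAt ℝ v (gPart x ⬝ᵥ gPart x))
    (hw : DifferentiableAt ℝ w (gPart x ⬝ᵥ gPart x)) {f h F H : V → ℝ} {D E : Idx → ℝ}
    (hF : HasGrad F x D) (hH : HasGrad H x E)
    (hf : f =ᶠ[nhds x] fun y => v (gPart y ⬝ᵥ gPart y) * F y)
    (hh : h =ᶠ[nhds x] fun y => w (gPart y ⬝ᵥ gPart y) * H y) :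
    bracket cM cG f h x = v (gPart x ⬝ᵥ gPart x) * w (gPart x ⬝ᵥ gPart x) *
      gradBracket (cM x) (fun k => r * gPart x k) D E := by
  obtain ⟨t, ht⟩ := hasGrad_radial hv
  obtain ⟨t', ht'⟩ := hasGrad_radial hw
  rw [bracket_eq_gradBracket ((ht.mul hF).congr hf) ((ht'.mul hH).congr hh), hr,
    ← gradBracket_casimir (t := F x * t) (t' := H x * t'), mul_smul, mul_smul]

/-- The structure functions of {M_i, M_j}_d. -/
def structM (a : Fin 3 → ℝ) (d : ℝ) (x : V) (k : Fin 3) : ℝ :=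
  mPart x k * qfun a d x - d * (qfun a d x)⁻¹ * pairing a x * gPart x k

theorem gradBracket_gamma_gamma (m g : Fin 3 → ℝ) (i j : Fin 3) :
    gradBracket m g (gammaGrad a d i x) (gammaGrad a d j x) = 0 := by
  simp [gradBracket, gammaGrad, qgrad, mI, gI]

theorem gradBracket_momentum_gamma (hx : 0 < 1 - d * ∑ i, a i * gPart x i * gPart x i)
    (m : Fin 3 → ℝ) (i j : Fin 3) :
    gradBracket m (fun k => qfun a d x * gPart x k) (momentumGrad a d i x) (gammaGrad a d j x)
      = ∑ k, eps i j k *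
        ((1 - d * (gPart x ⬝ᵥ gPart x) * a k) * (gPart x k * (qfun a d x)⁻¹)) := by
  have hQ := mul_inv_cancel₀ (qfun_pos hx).ne'
  have hq : qfun a d x ^ 2 = _ := Real.sq_sqrt hx.le
  simp only [Fin.sum_univ_three] at hq
  fin_cases i <;> fin_cases j <;>
    simp only [gradBracket, momentumGrad, gammaGrad, pairingGrad, qgrad, mI, gI, dotProduct,
      Fin.sum_univ_three, eps, Pi.add_apply, Pi.sub_apply, Pi.smul_apply, smul_eq_mul,
      Sum.elim_inl, Sum.elim_inr, Pi.zero_apply] <;>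
    norm_num [Pi.single_apply, -mul_eq_mul_left_iff, -mul_eq_mul_right_iff, -mul_eq_zero, -inv_pow] <;>
    generalize (qfun a d x)⁻¹ = Q at * <;>
    generalize qfun a d x = q at * <;>
    clear hx <;> grind

theorem gradBracket_momentum_momentum (hx : 0 < 1 - d * ∑ i, a i * gPart x i * gPart x i)
    (horth : gPart x ⬝ᵥ mPart x = 0) (i j : Fin 3) :
    gradBracket (structM a d x) (fun k => qfun a d x * gPart x k)
        (momentumGrad a d i x) (momentumGrad a d j x)
      = ∑ k, eps i j k * ((1 - d * (gPart x ⬝ᵥ gPart x) * a k) * momentum a d k x) := by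
  have hQ := mul_inv_cancel₀ (qfun_pos hx).ne'
  have hq : qfun a d x ^ 2 = _ := Real.sq_sqrt hx.le
  simp only [Fin.sum_univ_three, dotProduct] at hq horth
  fin_cases i <;> fin_cases j <;>
    simp only [gradBracket, structM, momentumGrad, momentum, gammaGrad, pairingGrad, pairing,
      qgrad, mI, gI, dotProduct,
      Fin.sum_univ_three, eps, Pi.add_apply, Pi.sub_apply, Pi.smul_apply, smul_eq_mul,
      Sum.elim_inl, Sum.elim_inr, Pi.zero_apply] <;>
    norm_num [Pi.single_apply, -mul_eq_mul_left_iff, -mul_eq_mul_right_iff, -mul_eq_zero, -inv_pow] <;>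
    generalize (qfun a d x)⁻¹ = Q at * <;>
    generalize qfun a d x = q at * <;>
    clear hx <;> grind

end

theorem sg_eq (a₁ a₂ a₃ d : ℝ) (x : V) : sg a₁ a₂ a₃ d x = (qfun ![a₁, a₂, a₃] d x)⁻¹ := by
  rw [sg, gfun, Real.sqrt_inv, qfun, Amat]
  congr 4
  exact Finset.sum_congr rfl fun i _ => by rw [mulVec_diagonal]; ring

theorem MAg_eq (a₁ a₂ a₃ : ℝ) (x : V) : MAg a₁ a₂ a₃ x = pairing ![a₁, a₂, a₃] x := by
  rw [MAg, pairing, Amat]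
  exact Finset.sum_congr rfl fun i _ => by rw [mulVec_diagonal]; ring

theorem eps_mul_cofactor {σ : Fin 3 → ℝ} (hσ : ∀ k, σ k ≠ 0) (i j k : Fin 3) :
    (∏ l ∈ Finset.univ.erase i, σ l)⁻¹ * σ j * (eps i j k * σ k ^ 2) = eps i j k * σ k := by
  have h0 := hσ 0
  have h1 := hσ 1
  have h2 := hσ 2
  have e0 : Finset.univ.erase (0 : Fin 3) = {1, 2} := by decide
  have e1 : Finset.univ.erase (1 : Fin 3) = {0, 2} := by decide
  have e2 : Finset.univ.erase (2 : Fin 3) = {0, 1} := by decide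
  fin_cases i <;> fin_cases j <;> fin_cases k <;> simp [eps, e0, e1, e2] <;> field_simp

theorem eps_mul_cofactor_cofactor {σ : Fin 3 → ℝ} (hσ : ∀ k, σ k ≠ 0) (i j k : Fin 3) :
    (∏ l ∈ Finset.univ.erase i, σ l)⁻¹ * (∏ l ∈ Finset.univ.erase j, σ l)⁻¹ *
        (eps i j k * σ k ^ 2)
      = eps i j k * (∏ l ∈ Finset.univ.erase k, σ l)⁻¹ := by
  have h0 := hσ 0
  have h1 := hσ 1
  have h2 := hσ 2
  have e0 : Finset.univ.erase (0 : Fin 3) = {1, 2} := by decide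
  have e1 : Finset.univ.erase (1 : Fin 3) = {0, 2} := by decide
  have e2 : Finset.univ.erase (2 : Fin 3) = {0, 1} := by decide
  fin_cases i <;> fin_cases j <;> fin_cases k <;> simp [eps, e0, e1, e2] <;> field_simp

/-- The factor √(1 − d⟨γ,γ⟩a_j) as a function of ⟨γ, γ⟩. -/
def radialFactor (a : Fin 3 → ℝ) (d : ℝ) (j : Fin 3) (s : ℝ) : ℝ :=
  Real.sqrt (1 - d * s * a j)

/-- The normalising factor of the momentum as a function of ⟨γ, γ⟩. -/
def radialCofactor (a : Fin 3 → ℝ) (d : ℝ) (j : Fin 3) (s : ℝ) : ℝ :=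
  (Real.sqrt (∏ i ∈ Finset.univ.erase j, (1 - d * s * a i)))⁻¹

theorem differentiableAt_radialFactor {a : Fin 3 → ℝ} {d s : ℝ} {j : Fin 3}
    (h : 0 < 1 - d * s * a j) : DifferentiableAt ℝ (radialFactor a d j) s := by
  unfold radialFactor
  exact DifferentiableAt.sqrt (by fun_prop) h.ne'

theorem differentiableAt_radialCofactor {a : Fin 3 → ℝ} {d s : ℝ}
    (h : ∀ j, 0 < 1 - d * s * a j) (j : Fin 3) :
    DifferentiableAt ℝ (radialCofactor a d j) s := by
  have hp : 0 < ∏ i ∈ Finset.univ.erase j, (1 - d * s * a i) :=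
    Finset.prod_pos fun i _ => h i
  have hd : DifferentiableAt ℝ (fun s => ∏ i ∈ Finset.univ.erase j, (1 - d * s * a i)) s := by
    fun_prop
  exact (hd.sqrt hp.ne').fun_inv (Real.sqrt_pos.2 hp).ne'

theorem radialCofactor_eq {a : Fin 3 → ℝ} {d s : ℝ} (h : ∀ j, 0 < 1 - d * s * a j) (j : Fin 3) :
    radialCofactor a d j s = (∏ i ∈ Finset.univ.erase j, radialFactor a d i s)⁻¹ := by
  rw [radialCofactor, Real.sqrt_prod _ fun i _ => (h i).le]
  rfl

theorem ghat_eventuallyEq {a₁ a₂ a₃ d : ℝ} {x : V} {j : Fin 3}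
    (h : 0 < 1 - d * (gPart x ⬝ᵥ gPart x) * ![a₁, a₂, a₃] j) :
    ghat a₁ a₂ a₃ d j =ᶠ[nhds x] fun y => radialFactor ![a₁, a₂, a₃] d j (gPart y ⬝ᵥ gPart y) *
      (gPart y j * (qfun ![a₁, a₂, a₃] d y)⁻¹) := by
  have hc : Continuous fun y : V => 1 - d * (gPart y ⬝ᵥ gPart y) * ![a₁, a₂, a₃] j := by
    unfold gPart
    fun_prop
  filter_upwards [hc.continuousAt.eventually_const_lt h] with y hy
  rw [ghat, Real.sqrt_mul' _ hy.le, ← sg, sg_eq, radialFactor]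
  ring

theorem mhat_eq (a₁ a₂ a₃ d : ℝ) (j : Fin 3) (x : V) :
    mhat a₁ a₂ a₃ d j x = radialCofactor ![a₁, a₂, a₃] d j (gPart x ⬝ᵥ gPart x) *
      momentum ![a₁, a₂, a₃] d j x := by
  rw [mhat, sg_eq, MAg_eq, radialCofactor, momentum, div_inv_eq_mul]
  ring

/-- On the level set ⟨γ,M⟩ = 0 the map (γ,M) ↦ (γ̂,M̂) pulls the
deformed bracket back to the standard Lie–Poisson bracket on e*(3). -/
theorem deformed_bracket_trivialization (a₁ a₂ a₃ d : ℝ) (x : V)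
    (hx : 0 < 1 - d * (gPart x ⬝ᵥ (Amat a₁ a₂ a₃).mulVec (gPart x)))
    (hpos : ∀ j : Fin 3, 0 < 1 - d * (gPart x ⬝ᵥ gPart x) * ![a₁, a₂, a₃] j)
    (horth : gPart x ⬝ᵥ mPart x = 0) (i j : Fin 3) :
    bracket (cMd a₁ a₂ a₃ d) (cGd a₁ a₂ a₃ d)
        (ghat a₁ a₂ a₃ d i) (ghat a₁ a₂ a₃ d j) x = 0 ∧
    bracket (cMd a₁ a₂ a₃ d) (cGd a₁ a₂ a₃ d)
        (mhat a₁ a₂ a₃ d i) (ghat a₁ a₂ a₃ d j) x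
      = ∑ k : Fin 3, eps i j k * ghat a₁ a₂ a₃ d k x ∧
    bracket (cMd a₁ a₂ a₃ d) (cGd a₁ a₂ a₃ d)
        (mhat a₁ a₂ a₃ d i) (mhat a₁ a₂ a₃ d j) x
      = ∑ k : Fin 3, eps i j k * mhat a₁ a₂ a₃ d k x := by
  have hu : 0 < 1 - d * ∑ i, ![a₁, a₂, a₃] i * gPart x i * gPart x i := by
    convert hx using 3
    rw [Amat]
    exact Finset.sum_congr rfl fun i _ => by rw [mulVec_diagonal]; ring
  have hG : cGd a₁ a₂ a₃ d x = fun k => qfun ![a₁, a₂, a₃] d x * gPart x k := by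
    funext k
    rw [cGd, sg_eq, div_inv_eq_mul, mul_comm]
  have hM : cMd a₁ a₂ a₃ d x = structM ![a₁, a₂, a₃] d x := by
    funext k
    rw [cMd, sg_eq, MAg_eq, structM, div_inv_eq_mul]
  have hg := fun k => ghat_eventuallyEq (hpos k)
  have hm := fun k => Eventually.of_forall (f := nhds x) (mhat_eq a₁ a₂ a₃ d k)
  have dg := fun k => differentiableAt_radialFactor (hpos k)
  have dm := differentiableAt_radialCofactor hpos
  have hσ (k) : radialFactor ![a₁, a₂, a₃] d k (gPart x ⬝ᵥ gPart x) ≠ 0 :=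
    (Real.sqrt_pos.2 (hpos k)).ne'
  have hsq (k) : radialFactor ![a₁, a₂, a₃] d k (gPart x ⬝ᵥ gPart x) ^ 2 =
      1 - d * (gPart x ⬝ᵥ gPart x) * ![a₁, a₂, a₃] k := Real.sq_sqrt (hpos k).le
  refine ⟨?_, ?_, ?_⟩
  · rw [bracket_mul_radial hG (dg i) (dg j) (hasGrad_gamma hu i) (hasGrad_gamma hu j)
      (hg i) (hg j), gradBracket_gamma_gamma, mul_zero]
  · rw [bracket_mul_radial hG (dm i) (dg j) (hasGrad_momentum hu i) (hasGrad_gamma hu j)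
      (hm i) (hg j), gradBracket_momentum_gamma hu, Finset.mul_sum]
    refine Finset.sum_congr rfl fun k _ => ?_
    rw [(hg k).eq_of_nhds, radialCofactor_eq hpos, ← hsq k]
    linear_combination (gPart x k * (qfun ![a₁, a₂, a₃] d x)⁻¹) * eps_mul_cofactor hσ i j k
  · rw [bracket_mul_radial hG (dm i) (dm j) (hasGrad_momentum hu i) (hasGrad_momentum hu j)
      (hm i) (hm j), hM, gradBracket_momentum_momentum hu horth, Finset.mul_sum]
    refine Finset.sum_congr rfl fun k _ => ?_
    rw [mhat_eq, radialCofactor_eq hpos, radialCofactor_eq hpos, radialCofactor_eq hpos, ← hsq k]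
    linear_combination momentum ![a₁, a₂, a₃] d k x * eps_mul_cofactor_cofactor hσ i j k
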